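/- arXiv:2101.02677 — 4 statements merged into one kernel-verified Lean document; each statement's English description precedes it below -/
import Mathlib

section
/- Let X ⊆ ℝⁿ be compact, let H be a reproducing kernel Hilbert space of continuous real-valued functions on X whose kernel K is continuous, and let γ : [0,T] → X be a bounded measurable trajectory. Then the linear functional on H given by g ↦ ∫₀ᵀ g(γ(τ)) dτ is bounded; consequently, by the Riesz representation theorem there exists a unique Γ_γ ∈ H (the occupation kernel corresponding to γ) with ⟨g, Γ_γ⟩_H = ∫₀ᵀ g(γ(τ)) dτ for all g ∈ H. -/
open scoped RealInnerProductSpace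

/-- A feature map whose kernel is continuous on a compact space is bounded. -/
theorem exists_bound_of_continuous_diagonal {X H : Type*} [TopologicalSpace X] [CompactSpace X]
    [NormedAddCommGroup H] [InnerProductSpace ℝ H] (K : X → X → ℝ) (k : X → H)
    (hK : ∀ x y, K x y = ⟪k y, k x⟫) (hKcont : Continuous fun p : X × X => K p.1 p.2) :
    ∃ B : ℝ, ∀ x, ‖k x‖ ≤ B := by
  have hdiag : Continuous fun x => K x x := hKcont.comp (continuous_id.prodMk continuous_id)
  obtain ⟨M, hM⟩ := (isCompact_range hdiag).bddAbove
  refine ⟨√M, fun x => Real.le_sqrt_of_sq_le ?_⟩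
  rw [← real_inner_self_eq_norm_sq, ← hK]
  exact hM ⟨x, rfl⟩

/-- **Riesz representation**: a continuous linear functional on a real Hilbert space is the
inner product with a unique vector. -/
theorem existsUnique_inner_eq {H : Type*} [NormedAddCommGroup H] [InnerProductSpace ℝ H]
    [CompleteSpace H] (L : H →L[ℝ] ℝ) : ∃! v : H, ∀ g : H, ⟪g, v⟫ = L g := by
  refine ⟨(InnerProductSpace.toDual ℝ H).symm L, fun g => ?_, fun w hw => ?_⟩
  · rw [real_inner_comm, InnerProductSpace.toDual_symm_apply]
  · refine ext_inner_left ℝ fun g => ?_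
    rw [hw g, real_inner_comm, InnerProductSpace.toDual_symm_apply]

/-- For a compact set `X ⊆ ℝⁿ`, an RKHS `H` of continuous real-valued
functions on `X` with continuous kernel `K` (with feature map `k`, so that
`K x y = (k y)(x)` and `⟪g, k x⟫ = g(x)`), and a bounded measurable trajectory
`γ : [0,T] → X`, the functional `g ↦ ∫₀ᵀ g(γ τ) dτ` is bounded, and hence there is a
unique occupation kernel `Γ_γ ∈ H` with `⟪g, Γ_γ⟫ = ∫₀ᵀ g(γ τ) dτ` for all `g ∈ H`. -/
theorem stmt_0
    (n : ℕ) (X : Set (EuclideanSpace ℝ (Fin n))) (hX : IsCompact X)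
    (H : Type*) [NormedAddCommGroup H] [InnerProductSpace ℝ H] [CompleteSpace H]
    (ev : H →ₗ[ℝ] (X → ℝ)) (hev : Function.Injective ev)
    (K : X → X → ℝ) (k : X → H)
    (hrep : ∀ (g : H) (x : X), ⟪g, k x⟫ = ev g x)
    (hker : ∀ x y : X, K x y = ev (k y) x)
    (hKcont : Continuous fun p : X × X => K p.1 p.2)
    (hcont : ∀ g : H, Continuous (ev g))
    (T : ℝ) (hT : 0 ≤ T)
    (γ : ℝ → X) (hγ : Measurable γ) :
    (∃ C : ℝ, ∀ g : H, |∫ τ in (0:ℝ)..T, ev g (γ τ)| ≤ C * ‖g‖) ∧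
      ∃! Γ : H, ∀ g : H, ⟪g, Γ⟫ = ∫ τ in (0:ℝ)..T, ev g (γ τ) := by
  have : CompactSpace X := isCompact_iff_compactSpace.mp hX
  obtain ⟨B, hB⟩ := exists_bound_of_continuous_diagonal K k
    (fun x y => by rw [hker, ← hrep]) hKcont
  have hbound : ∀ (g : H) (x : X), ‖ev g x‖ ≤ B * ‖g‖ := fun g x => by
    rw [← hrep, mul_comm]
    exact (norm_inner_le_norm g (k x)).trans
      (mul_le_mul_of_nonneg_left (hB x) (norm_nonneg g))
  have hintegrable : ∀ g : H, IntervalIntegrable (fun τ => ev g (γ τ)) MeasureTheory.volume 0 T :=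
    fun g => intervalIntegrable_const (c := B * ‖g‖) |>.mono_fun
      ((hcont g).measurable.comp hγ).aestronglyMeasurable
      (Filter.Eventually.of_forall fun τ => (hbound g (γ τ)).trans (le_abs_self _))
  have hC : ∀ g : H, ‖∫ τ in (0:ℝ)..T, ev g (γ τ)‖ ≤ B * T * ‖g‖ := fun g => by
    have h := intervalIntegral.norm_integral_le_of_norm_le_const
      (a := 0) (b := T) (f := fun τ => ev g (γ τ)) fun τ _ => hbound g (γ τ)
    rw [sub_zero, abs_of_nonneg hT] at h
    linarith
  refine ⟨⟨B * T, hC⟩, ?_⟩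
  let L : H →ₗ[ℝ] ℝ :=
    { toFun := fun g => ∫ τ in (0:ℝ)..T, ev g (γ τ)
      map_add' := fun f g => by
        simp only [map_add, Pi.add_apply]
        exact intervalIntegral.integral_add (hintegrable f) (hintegrable g)
      map_smul' := fun c g => by
        simp only [map_smul, Pi.smul_apply, RingHom.id_apply]
        exact intervalIntegral.integral_smul c _ }
  exact existsUnique_inner_eq (L.mkContinuous (B * T) hC)
end

section
/- Let R ⊆ ℝ² be compact and let H be a reproducing kernel Hilbert space of continuous real-valued functions on R with kernel K satisfying sup_{x∈R} K(x,x) < ∞. Let φ = (φ₁,φ₂) and ψ = (ψ₁,ψ₂) with φ₁,φ₂,ψ₁,ψ₂ ∈ H, and suppose φ is Lipschitz on R with Lipschitz constant L. Let s > 0, θ ∈ [0,2π), p ∈ R, and suppose r_φ, r_ψ : [0,T] → R are the unique solutions of ṗ = s·(cos θ, sin θ)ᵀ + φ(p) and ṗ = s·(cos θ, sin θ)ᵀ + ψ(p), respectively, both with initial condition p(0) = p. Then there exists a constant M (depending only on L, T, and sup_{x∈R} K(x,x)) such that for all t ∈ [0,T], ‖r_φ(t) − r_ψ(t)‖₂ ≤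 M·max_{i=1,2} ‖φ_i − ψ_i‖_H. -/
open scoped RealInnerProductSpace

/-- The Grönwall bound with zero initial error is linear in the defect. -/
lemma gronwallBound_zero_mul (K c m x : ℝ) :
    gronwallBound 0 K (c * m) x = gronwallBound 0 K c x * m := by
  unfold gronwallBound
  split_ifs <;> ring

/-- Pointwise bound for a vector represented by a kernel section of bounded norm. -/
lemma abs_eval_le_sqrt_mul_norm {X H : Type*} [NormedAddCommGroup H] [InnerProductSpace ℝ H]
    {ev : H →ₗ[ℝ] (X → ℝ)} {x : X} {kx : H} {κ : ℝ}
    (hrep : ∀ g : H, ⟪g, kx⟫ = ev g x) (hκ : ev kx x ≤ κ) (g : H) :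
    |ev g x| ≤ √κ * ‖g‖ := by
  have hk : ‖kx‖ ≤ √κ := by
    apply Real.le_sqrt_of_sq_le
    rwa [← real_inner_self_eq_norm_sq, hrep]
  calc |ev g x| = |⟪g, kx⟫| := by rw [hrep]
    _ ≤ ‖g‖ * ‖kx‖ := abs_real_inner_le_norm g kx
    _ ≤ ‖g‖ * √κ := by gcongr
    _ = √κ * ‖g‖ := mul_comm _ _

/-- A planar vector has Euclidean norm at most `√2` times a bound on its coordinates. -/
lemma EuclideanSpace.norm_le_sqrt_two_mul {v : EuclideanSpace ℝ (Fin 2)} {c : ℝ}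
    (h₀ : |v 0| ≤ c) (h₁ : |v 1| ≤ c) : ‖v‖ ≤ √2 * c := by
  have hc : 0 ≤ c := (abs_nonneg _).trans h₀
  rw [EuclideanSpace.norm_eq, Fin.sum_univ_two, ← Real.sqrt_sq hc, ← Real.sqrt_mul zero_le_two]
  apply Real.sqrt_le_sqrt
  simp only [Real.norm_eq_abs]
  linarith [pow_le_pow_left₀ (abs_nonneg _) h₀ 2, pow_le_pow_left₀ (abs_nonneg _) h₁ 2]

/-- Grönwall-type stability of trajectories with respect to the flow field.
For any Lipschitz constant `L`, time horizon `T ≥ 0` and diagonal kernel bound `κ`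
(`sup_{x∈R} K(x,x) ≤ κ < ∞`), there exists a constant `M` (depending only on `L`, `T`,
`κ`) such that: for every compact `R ⊆ ℝ²`, every RKHS `H` of continuous functions on
`R` with kernel `K` bounded by `κ` on the diagonal of `R`, all `φ = (φ₁,φ₂)`,
`ψ = (ψ₁,ψ₂)` with components in `H` such that `φ` is `L`-Lipschitz on `R`, and the
solutions `r_φ, r_ψ : [0,T] → R` of `ṗ = s(cos θ, sin θ)ᵀ + φ(p)` resp.
`ṗ = s(cos θ, sin θ)ᵀ + ψ(p)` with `p(0) = p ∈ R`, one has
`‖r_φ(t) − r_ψ(t)‖₂ ≤ M · max_i ‖φ_i − ψ_i‖_H` for all `t ∈ [0,T]`. -/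
theorem stmt_5 (L : NNReal) (T κ : ℝ) (hT : 0 ≤ T) (hκ : 0 ≤ κ) :
    ∃ M : ℝ,
      ∀ (R : Set (EuclideanSpace ℝ (Fin 2))), IsCompact R →
      ∀ (H : Type) [NormedAddCommGroup H] [InnerProductSpace ℝ H] [CompleteSpace H]
        (ev : H →ₗ[ℝ] (EuclideanSpace ℝ (Fin 2) → ℝ))
        (K : EuclideanSpace ℝ (Fin 2) → EuclideanSpace ℝ (Fin 2) → ℝ)
        (k : EuclideanSpace ℝ (Fin 2) → H),
        Function.Injective ev →
        (∀ g : H, ContinuousOn (ev g) R) →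
        (∀ g : H, ∀ x ∈ R, ⟪g, k x⟫ = ev g x) →
        (∀ x y, K x y = ev (k y) x) →
        (∀ x ∈ R, K x x ≤ κ) →
      ∀ (φ₁ φ₂ ψ₁ ψ₂ : H),
        LipschitzOnWith L
          (fun x => (WithLp.equiv 2 (Fin 2 → ℝ)).symm ![ev φ₁ x, ev φ₂ x]) R →
      ∀ (s θ : ℝ), 0 < s → θ ∈ Set.Ico 0 (2 * Real.pi) →
      ∀ p ∈ R,
      ∀ (rφ rψ : ℝ → EuclideanSpace ℝ (Fin 2)),
        rφ 0 = p → rψ 0 = p →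
        (∀ t ∈ Set.Icc (0:ℝ) T, rφ t ∈ R) →
        (∀ t ∈ Set.Icc (0:ℝ) T, rψ t ∈ R) →
        (∀ t ∈ Set.Icc (0:ℝ) T,
          HasDerivAt rφ
            ((WithLp.equiv 2 (Fin 2 → ℝ)).symm ![s * Real.cos θ, s * Real.sin θ]
              + (WithLp.equiv 2 (Fin 2 → ℝ)).symm ![ev φ₁ (rφ t), ev φ₂ (rφ t)]) t) →
        (∀ t ∈ Set.Icc (0:ℝ) T,
          HasDerivAt rψ
            ((WithLp.equiv 2 (Fin 2 → ℝ)).symm ![s * Real.cos θ, s * Real.sin θ]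
              + (WithLp.equiv 2 (Fin 2 → ℝ)).symm ![ev ψ₁ (rψ t), ev ψ₂ (rψ t)]) t) →
      ∀ t ∈ Set.Icc (0:ℝ) T,
        ‖rφ t - rψ t‖ ≤ M * max ‖φ₁ - ψ₁‖ ‖φ₂ - ψ₂‖ := by
  refine ⟨gronwallBound 0 L (√2 * √κ) T, ?_⟩
  intro R _ H _ _ _ ev K k _ _ hrep hK hKκ φ₁ φ₂ ψ₁ ψ₂ hφ s θ _ _ p _ rφ rψ hφ0 hψ0
    hφR hψR hφ' hψ' t ht
  set m := max ‖φ₁ - ψ₁‖ ‖φ₂ - ψ₂‖ with hm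
  have hm0 : 0 ≤ m := le_max_of_le_left (norm_nonneg _)
  have heval : ∀ x ∈ R, ∀ φ ψ : H, ‖φ - ψ‖ ≤ m → |ev ψ x - ev φ x| ≤ √κ * m := by
    intro x hx φ ψ hle
    have h := abs_eval_le_sqrt_mul_norm (fun g => hrep g x hx) (hK x x ▸ hKκ x hx) (φ - ψ)
    rw [map_sub, Pi.sub_apply, abs_sub_comm] at h
    exact h.trans (by gcongr)
  let v : EuclideanSpace ℝ (Fin 2) → EuclideanSpace ℝ (Fin 2) := fun x =>
    (WithLp.equiv 2 (Fin 2 → ℝ)).symm ![s * Real.cos θ, s * Real.sin θ]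
      + (WithLp.equiv 2 (Fin 2 → ℝ)).symm ![ev φ₁ x, ev φ₂ x]
  have hv : LipschitzOnWith L v R := by
    intro x hx y hy
    simpa only [v, edist_add_left] using hφ hx hy
  have hIco : ∀ u ∈ Set.Ico (0 : ℝ) T, u ∈ Set.Icc (0 : ℝ) T := fun u hu => ⟨hu.1, hu.2.le⟩
  have hdist := dist_le_of_approx_trajectories_ODE_of_mem (v := fun _ => v) (s := fun _ => R)
    (δ := 0) (εf := 0) (εg := √2 * (√κ * m)) (fun _ _ => hv)
    (fun u hu => (hφ' u hu).continuousAt.continuousWithinAt)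
    (fun u hu => (hφ' u (hIco u hu)).hasDerivWithinAt)
    (fun u _ => (dist_self _).le) (fun u hu => hφR u (hIco u hu))
    (fun u hu => (hψ' u hu).continuousAt.continuousWithinAt)
    (fun u hu => (hψ' u (hIco u hu)).hasDerivWithinAt)
    (fun u hu => by
      have hx := hψR u (hIco u hu)
      simp only [v, dist_eq_norm]
      apply EuclideanSpace.norm_le_sqrt_two_mul
      · simpa using heval _ hx φ₁ ψ₁ (le_max_left _ _)
      · simpa using heval _ hx φ₂ ψ₂ (le_max_right _ _))
    (fun u hu => hψR u (hIco u hu)) (by rw [hφ0, hψ0, dist_self]) t ht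
  rw [sub_zero, zero_add, ← mul_assoc, gronwallBound_zero_mul, dist_eq_norm] at hdist
  refine hdist.trans (mul_le_mul_of_nonneg_right ?_ hm0)
  exact gronwallBound_mono le_rfl (by positivity) L.coe_nonneg ht.2
end

section
/- Let X ⊆ ℝⁿ be compact, let H be a reproducing kernel Hilbert space of continuous real-valued functions on X with continuous kernel K, and let (s,t) ↦ γ_s(t) be a continuous map from [0,1] × [0,T] into X (a homotopy between the trajectories γ₀ and γ₁). For each s ∈ [0,1] let Γ_{γ_s} ∈ H denote the occupation kernel of γ_s. Then the map s ↦ Γ_{γ_s} from [0,1] to H is continuous in the norm of H. -/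
open scoped RealInnerProductSpace

/-- A feature map with jointly continuous kernel is norm-continuous. -/
theorem continuous_of_continuous_inner {X H : Type*} [TopologicalSpace X]
    [NormedAddCommGroup H] [InnerProductSpace ℝ H] {k : X → H}
    (hk : Continuous fun p : X × X => ⟪k p.1, k p.2⟫) : Continuous k := by
  rw [continuous_iff_continuousAt]
  intro x
  have hinner : Continuous fun y => ⟪k y - k x, k y - k x⟫ := by
    simp only [inner_sub_left, inner_sub_right]
    have hyy : Continuous fun y => ⟪k y, k y⟫ :=
      hk.comp (continuous_id.prodMk continuous_id)
    have hyx : Continuous fun y => ⟪k y, k x⟫ :=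
      hk.comp (continuous_id.prodMk continuous_const)
    have hxy : Continuous fun y => ⟪k x, k y⟫ :=
      hk.comp (continuous_const.prodMk continuous_id)
    fun_prop
  have hnorm : Continuous fun y => ‖k y - k x‖ := by
    simpa only [norm_eq_sqrt_real_inner] using hinner.sqrt
  rw [ContinuousAt, tendsto_iff_norm_sub_tendsto_zero]
  simpa using hnorm.tendsto x

/-- Continuity of occupation kernels along a homotopy. For a compact
`X ⊆ ℝⁿ`, an RKHS `H` of continuous functions on `X` with continuous kernel `K`, and a
continuous homotopy `(s,t) ↦ γ_s(t)` from `[0,1] × [0,T]` into `X`, the map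
`s ↦ Γ_{γ_s}` (occupation kernels) is norm-continuous from `[0,1]` into `H`. -/
theorem stmt_6
    (n : ℕ) (X : Set (EuclideanSpace ℝ (Fin n))) (hX : IsCompact X)
    (H : Type*) [NormedAddCommGroup H] [InnerProductSpace ℝ H] [CompleteSpace H]
    (ev : H →ₗ[ℝ] (X → ℝ)) (hev : Function.Injective ev)
    (K : X → X → ℝ) (k : X → H)
    (hrep : ∀ (g : H) (x : X), ⟪g, k x⟫ = ev g x)
    (hker : ∀ x y : X, K x y = ev (k y) x)
    (hKcont : Continuous fun p : X × X => K p.1 p.2)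
    (hcont : ∀ g : H, Continuous (ev g))
    (T : ℝ) (hT : 0 ≤ T)
    (γ : ℝ → ℝ → X)
    (hγ : ContinuousOn (fun q : ℝ × ℝ => γ q.1 q.2) (Set.Icc 0 1 ×ˢ Set.Icc 0 T))
    (Γ : ℝ → H)
    (hΓ : ∀ s ∈ Set.Icc (0:ℝ) 1, ∀ g : H, ⟪g, Γ s⟫ = ∫ t in (0:ℝ)..T, ev g (γ s t)) :
    ContinuousOn Γ (Set.Icc 0 1) := by
  have hk : Continuous k := by
    apply continuous_of_continuous_inner
    refine hKcont.congr fun p => ?_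
    rw [hker, ← hrep, real_inner_comm]
  let F : ℝ → ℝ → H := fun s t =>
    k (γ (Set.projIcc 0 1 zero_le_one s) (Set.projIcc 0 T hT t))
  have hF : Continuous (Function.uncurry F) := by
    refine hk.comp (hγ.comp_continuous
      (f := fun q : ℝ × ℝ => ((Set.projIcc 0 1 zero_le_one q.1 : ℝ),
        (Set.projIcc 0 T hT q.2 : ℝ))) ?_ ?_)
    · exact (continuous_subtype_val.comp (continuous_projIcc.comp continuous_fst)).prodMk
        (continuous_subtype_val.comp (continuous_projIcc.comp continuous_snd))
    · exact fun q => ⟨Subtype.coe_prop _, Subtype.coe_prop _⟩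
  refine (intervalIntegral.continuous_parametric_intervalIntegral_of_continuous'
    (μ := MeasureTheory.volume) hF 0 T).continuousOn.congr fun s hs => ?_
  refine ext_inner_left ℝ fun g => ?_
  have hint : IntervalIntegrable (F s) MeasureTheory.volume 0 T :=
    (hF.comp (continuous_const.prodMk continuous_id)).intervalIntegrable 0 T
  rw [hΓ s hs g]
  refine Eq.trans ?_ ((innerSL ℝ g).intervalIntegral_comp_comm hint)
  refine intervalIntegral.integral_congr fun t ht => ?_
  rw [Set.uIcc_of_le hT] at ht
  simp only [F, innerSL_apply_apply, hrep, Set.projIcc_of_mem zero_le_one hs,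
    Set.projIcc_of_mem hT ht]
end

section
/- Let H be a Hilbert space, let s ∈ ℕ, and let Γ_{1,φ}, …, Γ_{s,φ} and Γ_{1,ψ}, …, Γ_{s,ψ} be elements of H (the occupation kernels of the trajectories induced by flow-field estimates φ and ψ). Suppose there are constants B, C, T, ρ ≥ 0 such that ‖Γ_{j,φ}‖_H ≤ B·T and ‖Γ_{j,ψ}‖_H ≤ B·T for all j, and ‖Γ_{j,φ} − Γ_{j,ψ}‖_H ≤ C·T·ρ for all j. Let G_φ = (⟨Γ_{i,φ}, Γ_{j,φ}⟩_H)_{i,j=1}^s and G_ψ = (⟨Γ_{i,ψ}, Γ_{j,ψ}⟩_H)_{i,j=1}^s be the corresponding Gram matrices. Then the operator (spectral) norm of their difference satisfies ‖G_φ − G_ψ‖ ≤ S·T²·ρ with S = 2·s·B·C, a constant proportional to s and independent of T. (In the paper, ρ = ‖φ − ψ‖_H.) -/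
open scoped RealInnerProductSpace

/-- The spectral norm of a real square matrix is at most its size times a bound on its entries. -/
theorem norm_toEuclideanCLM_le_card_mul {n : Type*} [Fintype n] [DecidableEq n]
    (A : Matrix n n ℝ) {M : ℝ} (hM : 0 ≤ M) (hA : ∀ i j, |A i j| ≤ M) :
    ‖Matrix.toEuclideanCLM (𝕜 := ℝ) A‖ ≤ Fintype.card n * M := by
  refine ContinuousLinearMap.opNorm_le_bound _ (by positivity) fun x => ?_
  refine le_of_sq_le_sq ?_ (by positivity)
  rw [EuclideanSpace.real_norm_sq_eq, mul_pow, EuclideanSpace.real_norm_sq_eq x]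
  have row (i : n) : (Matrix.toEuclideanCLM (𝕜 := ℝ) A x) i ^ 2 ≤
      Fintype.card n * M ^ 2 * ∑ j, x j ^ 2 := by
    rw [Matrix.ofLp_toEuclideanCLM]
    refine (Finset.sum_mul_sq_le_sq_mul_sq Finset.univ (A i) x).trans ?_
    gcongr
    calc ∑ j, A i j ^ 2 ≤ ∑ _j : n, M ^ 2 :=
          Finset.sum_le_sum fun j _ => sq_le_sq.2 ((hA i j).trans (le_abs_self M))
      _ = Fintype.card n * M ^ 2 := by simp
  calc _ ≤ ∑ _i : n, Fintype.card n * M ^ 2 * ∑ j, x j ^ 2 :=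
        Finset.sum_le_sum fun i _ => row i
    _ = (Fintype.card n * M) ^ 2 * ∑ j, x j ^ 2 := by
        rw [Finset.sum_const, Finset.card_univ, nsmul_eq_mul]
        ring

theorem abs_inner_sub_inner_le {H : Type*} [NormedAddCommGroup H] [InnerProductSpace ℝ H]
    (a b c d : H) : |⟪a, b⟫ - ⟪c, d⟫| ≤ ‖a‖ * ‖b - d‖ + ‖a - c‖ * ‖d‖ := by
  have h : ⟪a, b⟫ - ⟪c, d⟫ = ⟪a, b - d⟫ + ⟪a - c, d⟫ := by
    rw [inner_sub_right, inner_sub_left]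
    ring
  rw [h]
  exact (abs_add_le _ _).trans
    (add_le_add (abs_real_inner_le_norm _ _) (abs_real_inner_le_norm _ _))

/-- Bound on the operator (spectral) norm of the difference of two Gram
matrices of occupation kernels. If `‖Γ_{j,φ}‖, ‖Γ_{j,ψ}‖ ≤ B·T` and
`‖Γ_{j,φ} − Γ_{j,ψ}‖ ≤ C·T·ρ` for all `j`, then
`‖G_φ − G_ψ‖ ≤ S·T²·ρ` with `S = 2·s·B·C`. -/
theorem stmt_11
    (H : Type*) [NormedAddCommGroup H] [InnerProductSpace ℝ H]
    (s : ℕ) (Γφ Γψ : Fin s → H)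
    (B C T ρ : ℝ) (hB : 0 ≤ B) (hC : 0 ≤ C) (hT : 0 ≤ T) (hρ : 0 ≤ ρ)
    (hΓφ : ∀ j, ‖Γφ j‖ ≤ B * T) (hΓψ : ∀ j, ‖Γψ j‖ ≤ B * T)
    (hdiff : ∀ j, ‖Γφ j - Γψ j‖ ≤ C * T * ρ) :
    ‖Matrix.toEuclideanCLM (𝕜 := ℝ)
        ((Matrix.of fun i j => ⟪Γφ i, Γφ j⟫) - (Matrix.of fun i j => ⟪Γψ i, Γψ j⟫))‖
      ≤ (2 * s * B * C) * T ^ 2 * ρ := by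
  have entry (i j : Fin s) :
      |((Matrix.of fun i j => ⟪Γφ i, Γφ j⟫) - (Matrix.of fun i j => ⟪Γψ i, Γψ j⟫) :
        Matrix (Fin s) (Fin s) ℝ) i j| ≤ 2 * (B * T * (C * T * ρ)) := by
    rw [Matrix.sub_apply, Matrix.of_apply, Matrix.of_apply]
    calc _ ≤ ‖Γφ i‖ * ‖Γφ j - Γψ j‖ + ‖Γφ i - Γψ i‖ * ‖Γψ j‖ := abs_inner_sub_inner_le _ _ _ _
      _ ≤ B * T * (C * T * ρ) + C * T * ρ * (B * T) := by
          gcongr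
          exacts [hΓφ i, hdiff j, hdiff i, hΓψ j]
      _ = 2 * (B * T * (C * T * ρ)) := by ring
  refine (norm_toEuclideanCLM_le_card_mul _ (by positivity) entry).trans_eq ?_
  rw [Fintype.card_fin]
  ring
end
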